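/- Point identification of the spillover effect on untreated individuals under one-sided noncompliance (Theorem 2, part 1). Assume Assumptions IV, SM, IRR and OSNC hold and P(D_{(i)}(0,1) ≠ 0) > 0. Then τ_S(0) = E[Y_i(0, D_{(i)}(0,1)) − Y_i(0,0) | D_{(i)}(0,1) ≠ 0] is well defined and τ_S(0) = −Δ^{01}_{00}E[Y_i(1−D_i)] / Δ^{01}_{00}E[D_{i(i)}^∨]. -/

import Mathlib

open MeasureTheory ProbabilityTheory

noncomputable section

/-- Real value of a Boolean indicator. -/
def b2r (b : Bool) : ℝ := if b then 1 else 0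

variable {Ω : Type*} {m : ℕ}

/-- Conditional expectation of `X` given the event `A`, i.e. `E[X·1_A]/P(A)`. -/
def cexp [MeasurableSpace Ω] (P : Measure Ω) (X : Ω → ℝ) (A : Set Ω) : ℝ :=
  (∫ ω in A, X ω ∂P) / (P A).toReal

/-- The event `{Z_i = z, Z_{(i)} = z'}` (all peer instruments equal `z'`). -/
def ZevM (Zi : Ω → Bool) (Zp : Ω → Fin m → Bool) (z z' : Bool) : Set Ω :=
  {ω | Zi ω = z ∧ ∀ j, Zp ω j = z'}

/-- `Δ^{zz'}_{ww'} E[X]`, where `X z z'` is the observed quantity under the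
instrument pattern `(z, z')`. -/
def dEM [MeasurableSpace Ω] (P : Measure Ω) (Zi : Ω → Bool) (Zp : Ω → Fin m → Bool)
    (X : Bool → Bool → Ω → ℝ) (z z' w w' : Bool) : ℝ :=
  cexp P (X z z') (ZevM Zi Zp z z') - cexp P (X w w') (ZevM Zi Zp w w')

theorem measurable_b2r : Measurable b2r := measurable_of_countable _

/-- Conditioning on an event generated by a random variable independent of `W` does not change
the expectation of a function of `W`. -/
theorem cexp_preimage_of_indepFun {α β : Type*} [MeasurableSpace Ω] [MeasurableSpace α]
    [MeasurableSpace β] {P : Measure Ω} [IsProbabilityMeasure P] {V : Ω → α} {W : Ω → β}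
    (h : IndepFun V W P) (hV : Measurable V) (hW : Measurable W) {S : Set α}
    (hS : MeasurableSet S) {g : β → ℝ} (hg : Measurable g) (hpos : 0 < P (V ⁻¹' S)) :
    cexp P (fun ω => g (W ω)) (V ⁻¹' S) = ∫ ω, g (W ω) ∂P := by
  have hind : Measurable (S.indicator (fun _ => (1 : ℝ))) := measurable_const.indicator hS
  have key := (h.comp hind hg).integral_fun_mul_eq_mul_integral
    (hind.comp hV).aestronglyMeasurable (hg.comp hW).aestronglyMeasurable
  have hmeas : MeasurableSet (V ⁻¹' S) := hV hS
  have e1 : ∫ ω, (S.indicator (fun _ => (1 : ℝ)) ∘ V) ω * (g ∘ W) ω ∂P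
      = ∫ ω in V ⁻¹' S, g (W ω) ∂P := by
    rw [← integral_indicator hmeas]
    congr 1
    ext ω
    by_cases hω : V ω ∈ S <;> simp [Set.indicator, hω]
  have e2 : ∫ ω, (S.indicator (fun _ => (1 : ℝ)) ∘ V) ω ∂P = (P (V ⁻¹' S)).toReal := by
    have : S.indicator (fun _ => (1 : ℝ)) ∘ V = (V ⁻¹' S).indicator 1 := by
      ext ω
      by_cases hω : V ω ∈ S <;> simp [Set.indicator, hω]
    rw [this, integral_indicator_one hmeas]
    rfl
  rw [e1, e2] at key
  have hne : (P (V ⁻¹' S)).toReal ≠ 0 := (ENNReal.toReal_pos hpos.ne' (measure_ne_top _ _)).ne'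
  rw [cexp, key, mul_div_assoc, mul_comm, div_mul_cancel₀]
  · rfl
  · exact hne

/-- Evaluating a table of reals at a countable random index is measurable. -/
theorem measurable_eval_countable {ι : Type*} [Countable ι] [MeasurableSpace ι]
    [MeasurableSingletonClass ι] {κ : Type*} [Countable κ] [MeasurableSpace κ]
    [MeasurableSingletonClass κ] :
    Measurable (fun p : (ι × κ) × (ι → κ → ℝ) => p.2 p.1.1 p.1.2) :=
  measurable_from_prod_countable_right fun x => by
    change Measurable fun f : ι → κ → ℝ => f x.1 x.2
    fun_prop

/-- A finite family of integrable functions evaluated at a measurable random index is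
integrable. -/
theorem integrable_eval_fintype {κ : Type*} [Fintype κ] [MeasurableSpace κ]
    [MeasurableSingletonClass κ] [MeasurableSpace Ω] {P : Measure Ω} {F : κ → Ω → ℝ}
    (hF : ∀ k, Integrable (F k) P) {K : Ω → κ} (hK : Measurable K) :
    Integrable (fun ω => F (K ω) ω) P := by
  classical
  have : (fun ω => F (K ω) ω) = fun ω => ∑ k, (K ⁻¹' {k}).indicator (F k) ω := by
    ext ω
    simp [Set.indicator, eq_comm]
  rw [this]
  exact integrable_finsetSum _ fun k _ => (hF k).indicator (hK (measurableSet_singleton k))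

/-- Theorem 2, part 1: point identification of the spillover effect `τ_S(0)` on
untreated individuals under one-sided noncompliance, multiple peers. -/
theorem spillover_effect_untreated_osnc
    [MeasurableSpace Ω] (P : Measure Ω) [IsProbabilityMeasure P]
    (m : ℕ) (hm : 1 ≤ m)
    (Zi : Ω → Bool) (Zp : Ω → Fin m → Bool)
    (Di : Bool → Bool → Ω → Bool) (Dp : Bool → Bool → Ω → Fin m → Bool)
    (Y : Bool → (Fin m → Bool) → Ω → ℝ)
    (hZi : Measurable Zi) (hZp : Measurable Zp)
    (hDi : ∀ z z', Measurable (Di z z')) (hDp : ∀ z z', Measurable (Dp z z'))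
    (hYm : ∀ d dp, Measurable (Y d dp)) (hYint : ∀ d dp, Integrable (Y d dp) P)
    (hZpos : ∀ z z', 0 < P (ZevM Zi Zp z z'))
    -- Assumption IV: independence and own-instrument monotonicity
    (hIndep : IndepFun (fun ω => (Zi ω, Zp ω))
      (fun ω => (fun z z' => Di z z' ω, fun z z' => Dp z z' ω,
        fun d dp => Y d dp ω)) P)
    (hIV : ∀ᵐ ω ∂P, (∀ z, Di false z ω ≤ Di true z ω) ∧
      ∀ zi j, Dp zi false ω j ≤ Dp zi true ω j)
    -- Assumption SM: monotonicity in the spillovers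
    (hSM : ∀ᵐ ω ∂P, (∀ zi, Di zi false ω ≤ Di zi true ω) ∧
      ∀ z j, Dp false z ω j ≤ Dp true z ω j)
    -- Assumption IRR: irrelevance
    (hIRR : ∀ᵐ ω ∂P, (∀ z, Di true z ω = Di false z ω → Dp true z ω = Dp false z ω) ∧
      ∀ zi, Dp zi true ω = Dp zi false ω → Di zi true ω = Di zi false ω)
    -- Assumption OSNC: one-sided noncompliance
    (hOSNC : ∀ᵐ ω ∂P, (∀ z, Di false z ω = false) ∧
      ∀ zi j, Dp zi false ω j = false)
    -- the event {D_{(i)}(0,1) ≠ 0} and τ_S(0)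
    (T : Set Ω)
    (hT : T = {ω | ∃ j, Dp false true ω j = true})
    (hTpos : 0 < P T)
    (τ : ℝ)
    (hτ : τ = cexp P
      (fun ω => Y false (Dp false true ω) ω - Y false (fun _ => false) ω) T) :
    τ =
      -(dEM P Zi Zp (fun z z' ω => Y (Di z z' ω) (Dp z z' ω) ω *
          (1 - b2r (Di z z' ω))) false true false false) /
        dEM P Zi Zp (fun z z' ω => (1 - b2r (Di z z' ω)) *
          ∏ j, (1 - b2r (Dp z z' ω j))) false true false false := by
  have hV : Measurable (fun ω => (Zi ω, Zp ω)) := hZi.prodMk hZp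
  have hW : Measurable (fun ω => (fun z z' => Di z z' ω, fun z z' => Dp z z' ω,
      fun d dp => Y d dp ω) : Ω → (Bool → Bool → Bool) × (Bool → Bool → Fin m → Bool) ×
        (Bool → (Fin m → Bool) → ℝ)) := by
    refine Measurable.prodMk ?_ (Measurable.prodMk ?_ ?_)
    · exact measurable_pi_lambda _ fun z => measurable_pi_lambda _ fun z' => hDi z z'
    · exact measurable_pi_lambda _ fun z => measurable_pi_lambda _ fun z' => hDp z z'
    · exact measurable_pi_lambda _ fun d => measurable_pi_lambda _ fun dp => hYm d dp
  have cexp_eq : ∀ z z' (g : (Bool → Bool → Bool) × (Bool → Bool → Fin m → Bool) ×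
      (Bool → (Fin m → Bool) → ℝ) → ℝ), Measurable g →
      cexp P (fun ω => g (fun z z' => Di z z' ω, fun z z' => Dp z z' ω,
        fun d dp => Y d dp ω)) (ZevM Zi Zp z z') =
      ∫ ω, g (fun z z' => Di z z' ω, fun z z' => Dp z z' ω, fun d dp => Y d dp ω) ∂P := by
    intro z z' g hg
    have hpre : ZevM Zi Zp z z' = (fun ω => (Zi ω, Zp ω)) ⁻¹' {(z, fun _ => z')} := by
      ext ω
      simp [ZevM, funext_iff]
    have hp := hZpos z z'
    rw [hpre] at hp ⊢
    exact cexp_preimage_of_indepFun hIndep hV hW (measurableSet_singleton _) hg hp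
  have cexp_outcome : ∀ z z', cexp P (fun ω => Y (Di z z' ω) (Dp z z' ω) ω *
      (1 - b2r (Di z z' ω))) (ZevM Zi Zp z z') =
      ∫ ω, Y (Di z z' ω) (Dp z z' ω) ω * (1 - b2r (Di z z' ω)) ∂P := by
    intro z z'
    refine cexp_eq z z' (fun t => t.2.2 (t.1 z z') (t.2.1 z z') * (1 - b2r (t.1 z z'))) ?_
    refine Measurable.mul ?_ (measurable_const.sub (measurable_b2r.comp (by fun_prop)))
    exact measurable_eval_countable.comp
      (f := fun t : (Bool → Bool → Bool) × (Bool → Bool → Fin m → Bool) ×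
        (Bool → (Fin m → Bool) → ℝ) => ((t.1 z z', t.2.1 z z'), t.2.2)) (by fun_prop)
  have cexp_untreated : ∀ z z', cexp P (fun ω => (1 - b2r (Di z z' ω)) *
      ∏ j, (1 - b2r (Dp z z' ω j))) (ZevM Zi Zp z z') =
      ∫ ω, (1 - b2r (Di z z' ω)) * ∏ j, (1 - b2r (Dp z z' ω j)) ∂P := by
    intro z z'
    refine cexp_eq z z' (fun t => (1 - b2r (t.1 z z')) * ∏ j, (1 - b2r (t.2.1 z z' j))) ?_
    refine (measurable_const.sub (measurable_b2r.comp (by fun_prop))).mul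
      (Finset.measurable_prod _ fun j _ => ?_)
    exact measurable_const.sub (measurable_b2r.comp (by fun_prop))
  have hTm : MeasurableSet T := by
    have : T = (Dp false true ⁻¹' {fun _ => false})ᶜ := by
      ext ω
      simp [hT, funext_iff]
    rw [this]
    exact (hDp false true (measurableSet_singleton _)).compl
  have o1 : ∫ ω, Y (Di false true ω) (Dp false true ω) ω * (1 - b2r (Di false true ω)) ∂P =
      ∫ ω, Y false (Dp false true ω) ω ∂P := by
    refine integral_congr_ae ?_
    filter_upwards [hOSNC] with ω h
    simp [h.1, b2r]
  have o0 : ∫ ω, Y (Di false false ω) (Dp false false ω) ω * (1 - b2r (Di false false ω)) ∂P =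
      ∫ ω, Y false (fun _ => false) ω ∂P := by
    refine integral_congr_ae ?_
    filter_upwards [hOSNC] with ω h
    have hD : Dp false false ω = fun _ => false := funext (h.2 false)
    simp [h.1, b2r, hD]
  have u1 : ∫ ω, (1 - b2r (Di false true ω)) * ∏ j, (1 - b2r (Dp false true ω j)) ∂P =
      1 - (P T).toReal := by
    have : ∫ ω, (1 - b2r (Di false true ω)) * ∏ j, (1 - b2r (Dp false true ω j)) ∂P =
        ∫ ω, Tᶜ.indicator 1 ω ∂P := by
      refine integral_congr_ae ?_
      filter_upwards [hOSNC] with ω h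
      by_cases hω : ω ∈ T
      · have hω' := hω
        rw [hT] at hω'
        obtain ⟨j, hj⟩ := hω'
        rw [Finset.prod_eq_zero (Finset.mem_univ j) (by simp [b2r, hj])]
        simp [hω]
      · have hω' := hω
        simp only [hT, Set.mem_ofPred_eq, not_exists, Bool.not_eq_true] at hω'
        simp [hω, hω', h.1, b2r]
    rw [this, integral_indicator_one hTm.compl, probReal_compl_eq_one_sub hTm]
    rfl
  have u0 : ∫ ω, (1 - b2r (Di false false ω)) * ∏ j, (1 - b2r (Dp false false ω j)) ∂P = 1 := by
    have : ∫ ω, (1 - b2r (Di false false ω)) * ∏ j, (1 - b2r (Dp false false ω j)) ∂P =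
        ∫ _, (1 : ℝ) ∂P := by
      refine integral_congr_ae ?_
      filter_upwards [hOSNC] with ω h
      simp [h.1, h.2, b2r]
    simp [this]
  have hnum : ∫ ω in T, (Y false (Dp false true ω) ω - Y false (fun _ => false) ω) ∂P =
      ∫ ω, Y false (Dp false true ω) ω ∂P - ∫ ω, Y false (fun _ => false) ω ∂P := by
    rw [← integral_sub (integrable_eval_fintype (hYint false) (hDp false true)) (hYint _ _)]
    refine setIntegral_eq_integral_of_forall_compl_eq_zero fun ω hω => ?_
    simp only [hT, Set.mem_ofPred_eq, not_exists, Bool.not_eq_true] at hω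
    rw [show Dp false true ω = fun _ => false from funext hω, sub_self]
  rw [hτ, dEM, dEM, cexp_outcome, cexp_outcome, cexp_untreated, cexp_untreated, o1, o0, u1, u0,
    cexp, hnum, sub_sub_cancel_left, neg_div_neg_eq]

end
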